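/- Let M ⊆ ℂ^p and N ⊆ ℂ^q be bounded open sets and D = M × N. Let ε₀ > 0 and set M'' = {a ∈ M : infDist(a, ℂ^p \ M) > ε₀} and N'' = {b ∈ N : infDist(b, ℂ^q \ N) > ε₀}. Let Γ be a subset of D × D which is closed in the subspace topology of D × D and satisfies Γ ⊆ (M'' × N) × (M × N''). Fix 0 < ε < ε₀/2 and let π : ℂ^{p+q} × ℂ^{p+q} → ℂ^{p+q} be the map π(x, y) = y − x. Then for every compact set K contained in the open ball of radius ε centered at 0 in ℂ^{p+q}, the set Γ ∩ π^{-1}(K) = {(x, y) ∈ Γ : y − x ∈ K} is compact. In particular, the restriction of π to Γ ∩ {(x, y) : ‖y − x‖ < ε} is a proper map onto its image in the ball of radius ε. -/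

import Mathlib

/-- A point closer to `x` than the distance from `x` to the complement of `s` lies in `s`. -/
theorem mem_of_dist_lt_infDist_compl {α : Type*} [PseudoMetricSpace α] {s : Set α} {x y : α}
    (h : dist x y < Metric.infDist x sᶜ) : y ∈ s := by
  by_contra hy
  exact h.not_ge (Metric.infDist_le_dist_of_mem hy)

/-- The properness assertion underlying Proposition 6.4: if `Γ` is a relatively closed subset
of `D × D` (`D = M × N`) contained in `(M'' × N) × (M × N'')`, where `M''` and `N''` are the
`ε₀`-shrinkings of the bounded open sets `M` and `N`, and `0 < ε < ε₀/2`, then for every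
compact set `K` contained in the Euclidean ball of radius `ε` centred at `0`, the set
`{(x, y) ∈ Γ : y - x ∈ K}` is compact. -/
theorem proper_near_diagonal
    (p q : ℕ)
    (M : Set (EuclideanSpace ℂ (Fin p))) (N : Set (EuclideanSpace ℂ (Fin q)))
    (hMopen : IsOpen M) (hMbdd : Bornology.IsBounded M)
    (hNopen : IsOpen N) (hNbdd : Bornology.IsBounded N)
    (ε₀ : ℝ) (hε₀ : 0 < ε₀)
    (Γ : Set ((EuclideanSpace ℂ (Fin p) × EuclideanSpace ℂ (Fin q)) ×
              (EuclideanSpace ℂ (Fin p) × EuclideanSpace ℂ (Fin q))))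
    (hΓsub : Γ ⊆ ({a ∈ M | ε₀ < Metric.infDist a Mᶜ} ×ˢ N) ×ˢ
                 (M ×ˢ {b ∈ N | ε₀ < Metric.infDist b Nᶜ}))
    (hΓclosed : closure Γ ∩ ((M ×ˢ N) ×ˢ (M ×ˢ N)) ⊆ Γ)
    (ε : ℝ) (hε : 0 < ε) (hεε₀ : ε < ε₀ / 2) :
    ∀ K : Set (EuclideanSpace ℂ (Fin p) × EuclideanSpace ℂ (Fin q)),
      IsCompact K →
      (∀ z ∈ K, Real.sqrt (‖z.1‖ ^ 2 + ‖z.2‖ ^ 2) < ε) →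
      IsCompact {w ∈ Γ | w.2 - w.1 ∈ K} := by
  intro K hK hKball
  have hclosure : ∀ w ∈ closure Γ,
      ε₀ ≤ Metric.infDist w.1.1 Mᶜ ∧ ε₀ ≤ Metric.infDist w.2.2 Nᶜ := by
    have hcl : IsClosed {w : (EuclideanSpace ℂ (Fin p) × EuclideanSpace ℂ (Fin q)) ×
        (EuclideanSpace ℂ (Fin p) × EuclideanSpace ℂ (Fin q)) |
        ε₀ ≤ Metric.infDist w.1.1 Mᶜ ∧ ε₀ ≤ Metric.infDist w.2.2 Nᶜ} := by
      refine IsClosed.and ?_ ?_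
      · exact isClosed_le continuous_const
          ((Metric.continuous_infDist_pt _).comp (by fun_prop))
      · exact isClosed_le continuous_const
          ((Metric.continuous_infDist_pt _).comp (by fun_prop))
    refine closure_minimal (fun v hv => ?_) hcl
    exact ⟨(hΓsub hv).1.1.2.le, (hΓsub hv).2.2.2.le⟩
  have hbdd : Bornology.IsBounded {w ∈ Γ | w.2 - w.1 ∈ K} := by
    refine ((hMbdd.prod hNbdd).prod (hMbdd.prod hNbdd)).subset fun w hw => ?_
    have h := hΓsub hw.1
    exact ⟨⟨h.1.1.1, h.1.2⟩, h.2.1, h.2.2.1⟩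
  refine Metric.isCompact_of_isClosed_isBounded (isClosed_of_closure_subset fun w hw => ?_) hbdd
  have hwΓ : w ∈ closure Γ := closure_mono (fun v hv => hv.1) hw
  have hwK : w.2 - w.1 ∈ K :=
    closure_minimal (s := {w ∈ Γ | w.2 - w.1 ∈ K}) (fun v hv => hv.2)
      (hK.isClosed.preimage (continuous_snd.sub continuous_fst)) hw
  obtain ⟨hM, hN⟩ := hclosure w hwΓ
  have hlt := hKball _ hwK
  have h1 : dist w.1.1 w.2.1 < ε := by
    rw [dist_comm, dist_eq_norm]
    exact (Real.le_sqrt_of_sq_le (le_add_of_nonneg_right (sq_nonneg _))).trans_lt hlt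
  have h2 : dist w.2.2 w.1.2 < ε := by
    rw [dist_eq_norm]
    exact (Real.le_sqrt_of_sq_le (le_add_of_nonneg_left (sq_nonneg _))).trans_lt hlt
  refine ⟨hΓclosed ⟨hwΓ, ⟨?_, ?_⟩, ?_, ?_⟩, hwK⟩
  · exact mem_of_dist_lt_infDist_compl (x := w.1.1) (by rw [dist_self]; linarith)
  · exact mem_of_dist_lt_infDist_compl (x := w.2.2) (by linarith)
  · exact mem_of_dist_lt_infDist_compl (x := w.1.1) (by linarith)
  · exact mem_of_dist_lt_infDist_compl (x := w.2.2) (by rw [dist_self]; linarith)
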